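/- Let r ≥ 2 and let P be a hereditary, multiplicative property of r-graphs containing graphs of arbitrarily large order. Then for every real α ≥ 1, λ^(α)(P) = π(P); in particular λ^(1)(P) = π(P), i.e., P is flat. -/

import Mathlib

/-!
Common definitions: `r`-uniform hypergraphs on vertex set `Fin n`, the polyform,
the parameter `λ^(α)`, degrees, properties of `r`-graphs, blow-ups, extremal
numbers and chromatic numbers.
-/

open Finset

/-- An `r`-uniform hypergraph on the vertex set `Fin n`. -/
structure HGraph (r n : ℕ) where
  edges : Finset (Finset (Fin n))
  uniform : ∀ e ∈ edges, e.card = r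

namespace HGraph

/-- The polyform `P_G(x) = r! ∑_{e ∈ E(G)} ∏_{i ∈ e} x_i`. -/
noncomputable def polyform {r n : ℕ} (G : HGraph r n) (x : Fin n → ℝ) : ℝ :=
  (r.factorial : ℝ) * ∑ e ∈ G.edges, ∏ i ∈ e, x i

/-- `λ^(α)(G)`: the maximum of the polyform over the unit sphere of `ℓ^α`. -/
noncomputable def lam {r n : ℕ} (α : ℝ) (G : HGraph r n) : ℝ :=
  sSup {y : ℝ | ∃ x : Fin n → ℝ, (∑ i, |x i| ^ α) = 1 ∧ y = G.polyform x}

/-- The degree of a vertex: the number of edges containing it. -/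
def degree {r n : ℕ} (G : HGraph r n) (v : Fin n) : ℕ :=
  (G.edges.filter (fun e => v ∈ e)).card

/-- Maximum degree `Δ(G)`. -/
def maxDeg {r n : ℕ} (G : HGraph r n) : ℕ :=
  Finset.univ.sup G.degree

/-- Minimum degree `δ(G)`. -/
noncomputable def minDeg {r n : ℕ} (G : HGraph r n) : ℕ :=
  sInf (Set.range G.degree)

/-- `G` is regular if all vertices have equal degrees. -/
def Regular {r n : ℕ} (G : HGraph r n) : Prop :=
  ∀ u v : Fin n, G.degree u = G.degree v

/-- The induced subgraph of `G` along the embedding `f`. -/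
def induce {r n m : ℕ} (G : HGraph r n) (f : Fin m ↪ Fin n) : HGraph r m where
  edges := Finset.univ.filter (fun e : Finset (Fin m) => e.map f ∈ G.edges)
  uniform := by
    intro e he
    rw [Finset.mem_filter] at he
    have h2 := G.uniform _ he.2
    rwa [Finset.card_map] at h2

/-- A property of `r`-graphs: a family closed under isomorphism (relabeling). -/
def IsProperty {r : ℕ} (P : ∀ n, Set (HGraph r n)) : Prop :=
  ∀ n : ℕ, ∀ σ : Equiv.Perm (Fin n), ∀ G ∈ P n, G.induce σ.toEmbedding ∈ P n

/-- A hereditary property: closed under taking induced subgraphs. -/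
def Hereditary {r : ℕ} (P : ∀ n, Set (HGraph r n)) : Prop :=
  ∀ n m : ℕ, ∀ f : Fin m ↪ Fin n, ∀ G ∈ P n, G.induce f ∈ P m

/-- A monotone property: closed under taking subgraphs. -/
def MonotoneProp {r : ℕ} (P : ∀ n, Set (HGraph r n)) : Prop :=
  ∀ n m : ℕ, ∀ f : Fin m ↪ Fin n, ∀ G ∈ P n, ∀ H : HGraph r m,
    (∀ e ∈ H.edges, e.map f ∈ G.edges) → H ∈ P m

/-- `B`, together with the projection `φ : V(B) → V(G)`, is (a copy of) the blow-up
`G(k 1, …, k n)` of `G`: the fiber over a vertex `i` of `G` has `k i` vertices, and the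
edges of `B` are exactly the transversals of the classes corresponding to edges of `G`. -/
def IsBlowup {r n N : ℕ} (G : HGraph r n) (k : Fin n → ℕ)
    (B : HGraph r N) (φ : Fin N → Fin n) : Prop :=
  (∀ i : Fin n, (Finset.univ.filter (fun v => φ v = i)).card = k i) ∧
  ∀ s : Finset (Fin N), s ∈ B.edges ↔ (Set.InjOn φ ↑s ∧ s.image φ ∈ G.edges)

/-- A multiplicative property: contains all blow-ups of all of its members. -/
def MultiplicativeProp {r : ℕ} (P : ∀ n, Set (HGraph r n)) : Prop :=
  ∀ n : ℕ, ∀ G ∈ P n, ∀ k : Fin n → ℕ, (∀ i, 0 < k i) →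
    ∀ N : ℕ, ∀ B : HGraph r N, ∀ φ : Fin N → Fin n, IsBlowup G k B φ → B ∈ P N

/-- The extremal number `ex(P, n)`: the maximum number of edges of a member of `P`
of order `n`. -/
noncomputable def exP {r : ℕ} (P : ∀ n, Set (HGraph r n)) (n : ℕ) : ℕ :=
  sSup {m : ℕ | ∃ G ∈ P n, G.edges.card = m}

/-- `λ^(α)(P, n)`: the maximum of `λ^(α)(G)` over members `G` of `P` of order `n`. -/
noncomputable def lamP {r : ℕ} (α : ℝ) (P : ∀ n, Set (HGraph r n)) (n : ℕ) : ℝ :=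
  sSup {y : ℝ | ∃ G ∈ P n, y = lam α G}

/-- The chromatic number: the least `k` such that the vertices can be `k`-colored
with no monochromatic edge (i.e. partitioned into `k` edgeless sets). -/
noncomputable def chrom {r n : ℕ} (G : HGraph r n) : ℕ :=
  sInf {k : ℕ | ∃ c : Fin n → Fin k, ∀ e ∈ G.edges, ¬ ∀ u ∈ e, ∀ w ∈ e, c u = c w}

/-- The weak chromatic number: the least `k` such that the vertices can be `k`-colored
with every edge getting `r` distinct colors (every class meets every edge in ≤ 1 vertex). -/
noncomputable def wchrom {r n : ℕ} (G : HGraph r n) : ℕ :=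
  sInf {k : ℕ | ∃ c : Fin n → Fin k, ∀ e ∈ G.edges, Set.InjOn c ↑e}

/-- `Mon(H)`: the (monotone, hereditary) property of all `r`-graphs containing no
subgraph isomorphic to `H`. -/
def MonP {r h : ℕ} (H : HGraph r h) : ∀ n, Set (HGraph r n) :=
  fun n => {G | ¬ ∃ f : Fin h ↪ Fin n, ∀ e ∈ H.edges, e.map f ∈ G.edges}

end HGraph

open HGraph

namespace HGraph

/-- The blow-up of `G` along a projection `φ`. -/
noncomputable def pullback {r n N : ℕ} (G : HGraph r n) (φ : Fin N → Fin n) : HGraph r N := by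
  classical
  exact
  { edges := Finset.univ.filter (fun s : Finset (Fin N) =>
      Set.InjOn φ ↑s ∧ s.image φ ∈ G.edges)
    uniform := by
      intro s hs
      rw [Finset.mem_filter] at hs
      rw [← Finset.card_image_of_injOn hs.2.1]
      exact G.uniform _ hs.2.2 }

theorem mem_pullback_edges {r n N : ℕ} (G : HGraph r n) (φ : Fin N → Fin n)
    (s : Finset (Fin N)) :
    s ∈ (G.pullback φ).edges ↔ Set.InjOn φ ↑s ∧ s.image φ ∈ G.edges := by
  classical
  simp only [pullback, Finset.mem_filter, Finset.mem_univ, true_and]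

theorem sum_prod_fiber_le_card_pullback {r n N : ℕ} (G : HGraph r n) (φ : Fin N → Fin n) :
    ∑ e ∈ G.edges, ∏ i ∈ e, (Finset.univ.filter (fun v => φ v = i)).card
      ≤ (G.pullback φ).edges.card := by
  classical
  have hcard : ∑ e ∈ G.edges, ∏ i ∈ e, (Finset.univ.filter (fun v => φ v = i)).card
      = (G.edges.sigma (fun e => e.pi (fun i => Finset.univ.filter (fun v => φ v = i)))).card := by
    simp only [Finset.card_sigma, Finset.card_pi]
  rw [hcard]
  have himage : ∀ (e : Finset (Fin n)) (f : ∀ i ∈ e, Fin N), (∀ i hi, φ (f i hi) = i) →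
      (e.attach.image (fun i => f i.1 i.2)).image φ = e := by
    intro e f hf
    ext j
    simp only [Finset.mem_image, Finset.mem_attach, true_and, Subtype.exists]
    constructor
    · rintro ⟨_, ⟨i, hi, rfl⟩, rfl⟩
      rwa [hf]
    · intro hj
      exact ⟨_, ⟨j, hj, rfl⟩, hf j hj⟩
  refine Finset.card_le_card_of_injOn
    (fun p => p.1.attach.image (fun i => p.2 i.1 i.2)) ?_ ?_
  · rintro ⟨e, f⟩ hp
    simp only [Finset.coe_sigma, Set.mem_sigma_iff, Finset.mem_coe, Finset.mem_pi,
      Finset.mem_filter, Finset.mem_univ, true_and] at hp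
    obtain ⟨he, hf⟩ := hp
    rw [Finset.mem_coe, mem_pullback_edges]
    refine ⟨?_, ?_⟩
    · intro a ha b hb hab
      simp only [Finset.coe_image, Set.mem_image, Finset.mem_coe, Finset.mem_attach, true_and,
        Subtype.exists] at ha hb
      obtain ⟨i, hi, rfl⟩ := ha
      obtain ⟨j, hj, rfl⟩ := hb
      rw [hf, hf] at hab
      subst hab
      rfl
    · have := himage e f hf
      convert he
  · rintro ⟨e, f⟩ hp ⟨e', f'⟩ hp' heq
    simp only [Finset.coe_sigma, Set.mem_sigma_iff, Finset.mem_coe, Finset.mem_pi,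
      Finset.mem_filter, Finset.mem_univ, true_and] at hp hp'
    simp only at heq
    have hee : e = e' := by
      rw [← himage e f hp.2, ← himage e' f' hp'.2, heq]
    subst hee
    have hff : f = f' := by
      funext i hi
      have hmem : f i hi ∈ e.attach.image (fun i => f' i.1 i.2) := by
        rw [← heq]
        exact Finset.mem_image.2 ⟨⟨i, hi⟩, Finset.mem_attach _ _, rfl⟩
      obtain ⟨⟨j, hj⟩, -, hj'⟩ := Finset.mem_image.1 hmem
      have hij : j = i := by
        rw [← hp'.2 j hj, ← hp.2 i hi, hj']
      subst hij
      exact hj'.symm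
    subst hff
    rfl

/-- A map onto `Fin n` with prescribed lower bounds for the fiber sizes. -/
theorem exists_map_le_card_fiber {n N : ℕ} (hn : 0 < n) (k : Fin n → ℕ) (hk : ∑ i, k i ≤ N) :
    ∃ φ : Fin N → Fin n, ∀ i, k i ≤ (Finset.univ.filter (fun v => φ v = i)).card := by
  classical
  have hcard : Fintype.card (Σ i, Fin (k i)) ≤ Fintype.card (Fin N) := by simpa using hk
  obtain ⟨g⟩ := Function.Embedding.nonempty_of_card_le hcard
  refine ⟨Function.extend g Sigma.fst (fun _ => ⟨0, hn⟩), fun i => ?_⟩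
  have h := Finset.card_le_card_of_injOn (s := (Finset.univ : Finset (Fin (k i))))
    (t := Finset.univ.filter
      (fun v => Function.extend g Sigma.fst (fun _ => (⟨0, hn⟩ : Fin n)) v = i))
    (fun j => g ⟨i, j⟩)
    (fun j _ => by simp [g.injective.extend_apply])
    (fun a _ b _ hab => by simpa using g.injective hab)
  simpa using h

theorem card_edges_le_choose {r n : ℕ} (G : HGraph r n) : G.edges.card ≤ n.choose r := by
  have h : G.edges ⊆ Finset.univ.powersetCard r := fun e he =>
    Finset.mem_powersetCard.2 ⟨Finset.subset_univ _, G.uniform e he⟩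
  simpa using Finset.card_le_card h

theorem bddAbove_card_edges {r : ℕ} (P : ∀ n, Set (HGraph r n)) (n : ℕ) :
    BddAbove {m : ℕ | ∃ G ∈ P n, G.edges.card = m} :=
  ⟨n.choose r, by rintro _ ⟨G, -, rfl⟩; exact G.card_edges_le_choose⟩

theorem card_edges_le_exP {r n : ℕ} {P : ∀ n, Set (HGraph r n)} {G : HGraph r n} (hG : G ∈ P n) :
    G.edges.card ≤ exP P n :=
  le_csSup (bddAbove_card_edges P n) ⟨G, hG, rfl⟩

theorem exists_card_edges_eq_exP {r n : ℕ} {P : ∀ n, Set (HGraph r n)} (hne : (P n).Nonempty) :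
    ∃ G ∈ P n, G.edges.card = exP P n := by
  obtain ⟨G, hG⟩ := hne
  exact Nat.sSup_mem (s := {m : ℕ | ∃ G ∈ P n, G.edges.card = m}) ⟨_, G, hG, rfl⟩
    (bddAbove_card_edges P n)

theorem exP_le_choose {r n : ℕ} {P : ∀ n, Set (HGraph r n)} (hne : (P n).Nonempty) :
    exP P n ≤ n.choose r := by
  obtain ⟨G, -, h⟩ := exists_card_edges_eq_exP hne
  exact h ▸ G.card_edges_le_choose

theorem polyform_mono {r n : ℕ} (G : HGraph r n) {x y : Fin n → ℝ} (hx : ∀ i, 0 ≤ x i)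
    (hxy : ∀ i, x i ≤ y i) : G.polyform x ≤ G.polyform y := by
  unfold polyform
  gcongr with e he i hi
  · exact fun i _ => hx i
  · exact hxy i

theorem polyform_smul {r n : ℕ} (G : HGraph r n) (c : ℝ) (x : Fin n → ℝ) :
    G.polyform (fun i => c * x i) = c ^ r * G.polyform x := by
  unfold polyform
  rw [mul_left_comm, Finset.mul_sum (a := c ^ r)]
  congr 1
  refine Finset.sum_congr rfl fun e he => ?_
  rw [Finset.prod_mul_distrib, Finset.prod_const, G.uniform e he]

theorem polyform_const {r n : ℕ} (G : HGraph r n) (c : ℝ) :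
    G.polyform (fun _ => c) = r.factorial * G.edges.card * c ^ r := by
  unfold polyform
  rw [Finset.sum_congr rfl (g := fun _ => c ^ r)
    fun e he => by rw [Finset.prod_const, G.uniform e he]]
  simp [mul_assoc]

theorem polyform_le_polyform_abs {r n : ℕ} (G : HGraph r n) (x : Fin n → ℝ) :
    G.polyform x ≤ G.polyform (fun i => |x i|) := by
  unfold polyform
  refine mul_le_mul_of_nonneg_left (Finset.sum_le_sum fun e _ => ?_) (by positivity)
  rw [← Finset.abs_prod]
  exact le_abs_self _

/-- Blowing up proportionally to a weight vector bounds the polyform by extremal numbers. -/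
theorem pow_mul_polyform_le_exP {r n N : ℕ} {P : ∀ n, Set (HGraph r n)}
    (hmul : MultiplicativeProp P) {G : HGraph r n} (hG : G ∈ P n) {x : Fin n → ℝ}
    (hx : ∀ i, 0 ≤ x i) (hsum : ∑ i, x i = 1) (hN : n ≤ N) :
    ((N : ℝ) - n) ^ r * G.polyform x ≤ r.factorial * exP P N := by
  have hn : 0 < n := by
    rcases Nat.eq_zero_or_pos n with rfl | h
    · simp at hsum
    · exact h
  have hm : (0 : ℝ) ≤ (N : ℝ) - n := by
    rw [sub_nonneg]; exact_mod_cast hN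
  have hk : ∑ i, (⌊((N : ℝ) - n) * x i⌋₊ + 1) ≤ N := by
    have h : ((∑ i, (⌊((N : ℝ) - n) * x i⌋₊ + 1) : ℕ) : ℝ) ≤ N := by
      push_cast
      calc ∑ i, ((⌊((N : ℝ) - n) * x i⌋₊ : ℝ) + 1)
          ≤ ∑ i, (((N : ℝ) - n) * x i + 1) := by
            gcongr with i
            exact Nat.floor_le (mul_nonneg hm (hx i))
        _ = N := by
            rw [Finset.sum_add_distrib, ← Finset.mul_sum, hsum]
            simp
    exact_mod_cast h
  obtain ⟨φ, hφ⟩ := exists_map_le_card_fiber hn _ hk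
  have hB : G.pullback φ ∈ P N :=
    hmul n G hG (fun i => (Finset.univ.filter (fun v => φ v = i)).card)
      (fun i => (Nat.succ_pos _).trans_le (hφ i)) N _ φ
      ⟨fun _ => rfl, fun s => G.mem_pullback_edges φ s⟩
  rw [← polyform_smul]
  calc G.polyform (fun i => ((N : ℝ) - n) * x i)
      ≤ G.polyform (fun i => ((Finset.univ.filter (fun v => φ v = i)).card : ℝ)) := by
        refine G.polyform_mono (fun i => mul_nonneg hm (hx i)) fun i => ?_
        refine (Nat.lt_floor_add_one _).le.trans ?_
        exact_mod_cast hφ i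
    _ ≤ r.factorial * exP P N := by
        unfold polyform
        refine mul_le_mul_of_nonneg_left ?_ (by positivity)
        beta_reduce
        exact_mod_cast (G.sum_prod_fiber_le_card_pullback φ).trans (card_edges_le_exP hB)

theorem tendsto_one_sub_div_pow (n r : ℕ) :
    Filter.Tendsto (fun N : ℕ => (((N : ℝ) - n) / N) ^ r) Filter.atTop (nhds 1) := by
  have h : Filter.Tendsto (fun N : ℕ => 1 - (n : ℝ) / N) Filter.atTop (nhds (1 - 0)) :=
    tendsto_const_nhds.sub (tendsto_const_div_atTop_nhds_zero_nat _)
  have h2 := h.pow r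
  rw [sub_zero, one_pow] at h2
  refine h2.congr' ?_
  filter_upwards [Filter.eventually_gt_atTop 0] with N hN
  have : (N : ℝ) ≠ 0 := by positivity
  rw [sub_div, div_self this]

/-- The values of polyforms of members of `P` on the standard simplices. -/
def lagrangianValues {r : ℕ} (P : ∀ n, Set (HGraph r n)) : Set ℝ :=
  {y | ∃ n, ∃ G ∈ P n, ∃ x : Fin n → ℝ, (∀ i, 0 ≤ x i) ∧ ∑ i, x i = 1 ∧ G.polyform x = y}

theorem polyform_mul_le_exP_div {r n N : ℕ} {P : ∀ n, Set (HGraph r n)}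
    (hmul : MultiplicativeProp P) {G : HGraph r n} (hG : G ∈ P n) {x : Fin n → ℝ}
    (hx : ∀ i, 0 ≤ x i) (hsum : ∑ i, x i = 1) (hN : n ≤ N) :
    (((N : ℝ) - n) / N) ^ r * G.polyform x ≤ r.factorial * exP P N / (N : ℝ) ^ r := by
  rw [div_pow, div_mul_eq_mul_div]
  exact div_le_div_of_nonneg_right (pow_mul_polyform_le_exP hmul hG hx hsum hN) (by positivity)

theorem bddAbove_lagrangianValues {r : ℕ} {P : ∀ n, Set (HGraph r n)}
    (hmul : MultiplicativeProp P) (hne : ∀ n, (P n).Nonempty) :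
    BddAbove (lagrangianValues P) := by
  refine ⟨1, ?_⟩
  rintro _ ⟨n, G, hG, x, hx, hsum, rfl⟩
  have h := (tendsto_one_sub_div_pow n r).mul_const (G.polyform x)
  rw [one_mul] at h
  refine le_of_tendsto h ?_
  filter_upwards [Filter.eventually_ge_atTop n] with N hN
  refine (polyform_mul_le_exP_div hmul hG hx hsum hN).trans ?_
  refine div_le_one_of_le₀ ?_ (by positivity)
  have h1 : r.factorial * exP P N ≤ N ^ r := by
    calc r.factorial * exP P N ≤ r.factorial * N.choose r := by
          gcongr
          exact exP_le_choose (hne N)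
      _ = N.descFactorial r := (Nat.descFactorial_eq_factorial_mul_choose N r).symm
      _ ≤ N ^ r := Nat.descFactorial_le_pow N r
  exact_mod_cast h1

theorem exP_div_pow_mem_lagrangianValues {r n : ℕ} {P : ∀ n, Set (HGraph r n)} (hn : 0 < n)
    (hne : (P n).Nonempty) : r.factorial * exP P n / (n : ℝ) ^ r ∈ lagrangianValues P := by
  obtain ⟨G, hG, hc⟩ := exists_card_edges_eq_exP hne
  have hn' : (n : ℝ) ≠ 0 := by positivity
  refine ⟨n, G, hG, fun _ => (n : ℝ)⁻¹, fun _ => by positivity, by simp [hn'], ?_⟩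
  rw [polyform_const, hc, inv_pow, div_eq_mul_inv]

theorem tendsto_exP_div_pow {r : ℕ} {P : ∀ n, Set (HGraph r n)}
    (hmul : MultiplicativeProp P) (hne : ∀ n, (P n).Nonempty) :
    Filter.Tendsto (fun n : ℕ => r.factorial * exP P n / (n : ℝ) ^ r)
      Filter.atTop (nhds (sSup (lagrangianValues P))) := by
  have hbdd := bddAbove_lagrangianValues hmul hne
  rw [tendsto_order]
  constructor
  · intro a ha
    obtain ⟨_, ⟨n, G, hG, x, hx, hsum, rfl⟩, hlt⟩ :=
      exists_lt_of_lt_csSup ⟨_, exP_div_pow_mem_lagrangianValues one_pos (hne 1)⟩ ha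
    have h := (tendsto_one_sub_div_pow n r).mul_const (G.polyform x)
    rw [one_mul] at h
    filter_upwards [h.eventually_const_lt hlt, Filter.eventually_ge_atTop n] with N hN hnN
    exact hN.trans_le (polyform_mul_le_exP_div hmul hG hx hsum hnN)
  · intro a ha
    filter_upwards [Filter.eventually_gt_atTop 0] with n hn
    exact (le_csSup hbdd (exP_div_pow_mem_lagrangianValues hn (hne n))).trans_lt ha

theorem tendsto_exP_div_choose {r : ℕ} {P : ∀ n, Set (HGraph r n)}
    (hmul : MultiplicativeProp P) (hne : ∀ n, (P n).Nonempty) :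
    Filter.Tendsto (fun n : ℕ => (exP P n : ℝ) / (n.choose r : ℝ))
      Filter.atTop (nhds (sSup (lagrangianValues P))) := by
  have h2 : Filter.Tendsto (fun n : ℕ => (n : ℝ) ^ r / (r.factorial * n.choose r))
      Filter.atTop (nhds 1) := by
    have h := (isEquivalent_choose r).symm
    rw [Asymptotics.isEquivalent_iff_tendsto_one] at h
    · refine h.congr fun n => ?_
      rw [Pi.div_apply, div_div]
    · filter_upwards [Filter.eventually_ge_atTop r] with n hn
      exact_mod_cast (Nat.choose_pos hn).ne'
  have h3 := (tendsto_exP_div_pow hmul hne).mul h2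
  rw [mul_one] at h3
  refine h3.congr' ?_
  filter_upwards [Filter.eventually_ge_atTop (r + 1)] with n hn
  have hn0 : (n : ℝ) ≠ 0 := by
    have : n ≠ 0 := by omega
    exact_mod_cast this
  have hr0 : (r.factorial : ℝ) ≠ 0 := by positivity
  field_simp

theorem polyform_le_of_sum_rpow_eq_one {r n : ℕ} {P : ∀ n, Set (HGraph r n)}
    (hmul : MultiplicativeProp P) (hne : ∀ n, (P n).Nonempty) {G : HGraph r n} (hG : G ∈ P n)
    {α : ℝ} (hα : 1 ≤ α) {x : Fin n → ℝ} (hx : ∑ i, |x i| ^ α = 1) :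
    G.polyform x ≤ (n : ℝ) ^ ((r : ℝ) - r / α) * sSup (lagrangianValues P) := by
  have hα0 : 0 < α := by linarith
  have hbdd := bddAbove_lagrangianValues hmul hne
  have hL : 0 ≤ sSup (lagrangianValues P) := by
    refine le_trans ?_ (le_csSup hbdd (exP_div_pow_mem_lagrangianValues one_pos (hne 1)))
    positivity
  set S := ∑ i, |x i| with hS
  have hS0 : 0 ≤ S := Finset.sum_nonneg fun i _ => abs_nonneg _
  have hSpos : 0 < S := by
    refine hS0.lt_of_ne fun h => ?_
    have h0 := (Finset.sum_eq_zero_iff_of_nonneg fun i _ => abs_nonneg (x i)).1 h.symm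
    rw [Finset.sum_congr rfl (g := fun _ => (0 : ℝ)) fun i hi => by
      rw [h0 i hi, Real.zero_rpow hα0.ne']] at hx
    simp at hx
  have hpow : S ^ r ≤ (n : ℝ) ^ ((r : ℝ) - r / α) := by
    have h := Real.rpow_sum_le_const_mul_sum_rpow (Finset.univ : Finset (Fin n)) x hα
    rw [hx, mul_one, Finset.card_univ, Fintype.card_fin, ← hS] at h
    have h' := Real.rpow_le_rpow (by positivity) h (by positivity : (0 : ℝ) ≤ r / α)
    rw [← Real.rpow_mul hS0, ← Real.rpow_mul (by positivity), mul_div_cancel₀ _ hα0.ne',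
      Real.rpow_natCast] at h'
    convert h' using 2
    field_simp
  calc G.polyform x ≤ G.polyform (fun i => |x i|) := G.polyform_le_polyform_abs x
    _ = S ^ r * G.polyform (fun i => S⁻¹ * |x i|) := by
        rw [← polyform_smul]
        congr 1
        funext i
        rw [mul_inv_cancel_left₀ hSpos.ne']
    _ ≤ S ^ r * sSup (lagrangianValues P) := by
        gcongr
        refine le_csSup hbdd ⟨n, G, hG, _, fun i => by positivity, ?_, rfl⟩
        rw [← Finset.mul_sum, ← hS, inv_mul_cancel₀ hSpos.ne']
    _ ≤ _ := by gcongr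

theorem sum_abs_rpow_const {n : ℕ} (hn : 0 < n) {α : ℝ} (hα : 1 ≤ α) :
    ∑ _i : Fin n, |(n : ℝ) ^ (-(1 / α))| ^ α = 1 := by
  have hn' : (0 : ℝ) < n := by positivity
  have hα0 : α ≠ 0 := by linarith
  rw [Finset.sum_const, Finset.card_univ, Fintype.card_fin, abs_of_pos (by positivity),
    ← Real.rpow_mul hn'.le, neg_mul, one_div_mul_cancel hα0, Real.rpow_neg_one, nsmul_eq_mul,
    mul_inv_cancel₀ hn'.ne']

section Bounds

variable {r n : ℕ} {P : ∀ n, Set (HGraph r n)} {α : ℝ}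

theorem lam_le (hmul : MultiplicativeProp P) (hne : ∀ n, (P n).Nonempty) {G : HGraph r n}
    (hG : G ∈ P n) (hα : 1 ≤ α) (hn : 0 < n) :
    lam α G ≤ (n : ℝ) ^ ((r : ℝ) - r / α) * sSup (lagrangianValues P) := by
  refine csSup_le ⟨_, _, sum_abs_rpow_const hn hα, rfl⟩ ?_
  rintro _ ⟨x, hx, rfl⟩
  exact polyform_le_of_sum_rpow_eq_one hmul hne hG hα hx

theorem lamP_le (hmul : MultiplicativeProp P) (hne : ∀ n, (P n).Nonempty)
    (hα : 1 ≤ α) (hn : 0 < n) :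
    lamP α P n ≤ (n : ℝ) ^ ((r : ℝ) - r / α) * sSup (lagrangianValues P) := by
  obtain ⟨G, hG⟩ := hne n
  refine csSup_le ⟨_, G, hG, rfl⟩ ?_
  rintro _ ⟨G, hG, rfl⟩
  exact lam_le hmul hne hG hα hn

theorem exP_mul_le_lamP (hmul : MultiplicativeProp P) (hne : ∀ n, (P n).Nonempty)
    (hα : 1 ≤ α) (hn : 0 < n) :
    r.factorial * exP P n * (n : ℝ) ^ (-((r : ℝ) / α)) ≤ lamP α P n := by
  obtain ⟨G, hG, hc⟩ := exists_card_edges_eq_exP (hne n)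
  have h1 : lam α G ≤ lamP α P n := by
    refine le_csSup ⟨(n : ℝ) ^ ((r : ℝ) - r / α) * sSup (lagrangianValues P), ?_⟩ ⟨G, hG, rfl⟩
    rintro _ ⟨G, hG, rfl⟩
    exact lam_le hmul hne hG hα hn
  have h2 : G.polyform (fun _ => (n : ℝ) ^ (-(1 / α))) ≤ lam α G := by
    refine le_csSup ⟨(n : ℝ) ^ ((r : ℝ) - r / α) * sSup (lagrangianValues P), ?_⟩
      ⟨_, sum_abs_rpow_const hn hα, rfl⟩
    rintro _ ⟨x, hx, rfl⟩
    exact polyform_le_of_sum_rpow_eq_one hmul hne hG hα hx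
  rw [polyform_const, hc, ← Real.rpow_natCast, ← Real.rpow_mul (by positivity)] at h2
  refine le_trans (le_of_eq ?_) (h2.trans h1)
  congr 2
  ring

end Bounds

end HGraph

/-- Theorem 4: every hereditary, multiplicative property `P` of
`r`-graphs (containing graphs of every order) is flat: for every `α ≥ 1`,
`λ^(α)(P) = π(P)`, i.e. the two limits exist and are equal. -/
theorem stmt16 {r : ℕ} (hr : 2 ≤ r) (P : ∀ n, Set (HGraph r n))
    (hprop : IsProperty P) (hher : Hereditary P) (hmul : MultiplicativeProp P)
    (hne : ∀ n, (P n).Nonempty) (α : ℝ) (hα : 1 ≤ α) :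
    ∃ L : ℝ,
      Filter.Tendsto (fun n : ℕ => lamP α P n * (n : ℝ) ^ ((r : ℝ) / α - r))
        Filter.atTop (nhds L) ∧
      Filter.Tendsto (fun n : ℕ => (exP P n : ℝ) / (n.choose r : ℝ))
        Filter.atTop (nhds L) := by
  refine ⟨sSup (lagrangianValues P), ?_, tendsto_exP_div_choose hmul hne⟩
  refine tendsto_of_tendsto_of_tendsto_of_le_of_le' (tendsto_exP_div_pow hmul hne)
    tendsto_const_nhds ?_ ?_
  · filter_upwards [Filter.eventually_gt_atTop 0] with n hn
    have hn' : (0 : ℝ) < n := by positivity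
    refine le_trans (le_of_eq ?_)
      (mul_le_mul_of_nonneg_right (exP_mul_le_lamP hmul hne hα hn) (by positivity))
    rw [mul_assoc, ← Real.rpow_add hn', div_eq_mul_inv, ← Real.rpow_natCast,
      ← Real.rpow_neg hn'.le]
    congr 2
    ring
  · filter_upwards [Filter.eventually_gt_atTop 0] with n hn
    have hn' : (0 : ℝ) < n := by positivity
    refine (mul_le_mul_of_nonneg_right (lamP_le hmul hne hα hn) (by positivity)).trans
      (le_of_eq ?_)
    rw [mul_right_comm, ← Real.rpow_add hn']
    simp
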